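/- (Sparse SDP relaxation convergence) Let [n] = I_1 ∪ ... ∪ I_t be a cover satisfying the running intersection property: for every i ∈ {2,...,t} there exists k ∈ {1,...,i−1} with I_i ∩ (I_1 ∪ ... ∪ I_{i−1}) ⊆ I_k. For each i, let G_i(x) be a q_i × q_i symmetric matrix whose entries are affine (degree ≤ 1) polynomials depending only on the variables x(I_i) = (x_j)_{j ∈ I_i}, and suppose each K_i = {x : G_i(x) ⪰ 0} is compact with nonempty interior (as a subset of ℝ^{|I_i|}). Let K = {x ∈ ℝ^n : G_i(x) ⪰ 0 for all i = 1,...,t}, let f = Σ_{i=1}^t f_i with each f_i ∈ ℝ[x(I_i)], and set f* = min_{x ∈ K} f(x). For each m ∈ ℕ define f^sps_m = sup{ r ∈ ℝ : f − r ∈ Σ_{i=1}^t H_m(G_i) }, where H_m(G_i) is the set of polynomials of the form λ_0 + Σ_{k=1}^m ⟨Λ_k, G_i(x)^{⊗k}⟩ with λ_0 ≥ 0 real and each Λ_k a q_i^k × q_i^k positive semidefinite real matrix. Then the sequence (f^sps_m)_{m ∈ ℕ} is nondecreasing, f^sps_m ≤ f* for all m, and f^sps_m → f* as m → ∞. -/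

import Mathlib

open scoped BigOperators

noncomputable section

/-- The `k`-fold Kronecker power of a matrix, with rows and columns indexed by
functions `Fin k → ι` (a type of cardinality `(#ι)^k`):
`(M^{⊗k})_{a,b} = ∏ᵢ M_{a i, b i}`. -/
def kronPow {ι : Type*} {R : Type*} [CommMonoid R] (M : Matrix ι ι R) (k : ℕ) :
    Matrix (Fin k → ι) (Fin k → ι) R :=
  Matrix.of fun a b => ∏ i, M (a i) (b i)

/-- Trace inner product `⟨Λ, B⟩ = tr(Λᵀ B) = ∑ᵢⱼ Λᵢⱼ Bᵢⱼ` of a real matrix against a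
polynomial matrix. -/
def tipP {n : ℕ} {ι : Type*} [Fintype ι] (Λ : Matrix ι ι ℝ)
    (B : Matrix ι ι (MvPolynomial (Fin n) ℝ)) : MvPolynomial (Fin n) ℝ :=
  ∑ i, ∑ j, MvPolynomial.C (Λ i j) * B i j

/-- The truncation `H_m(G)`: polynomials `λ₀ + ∑_{k=1}^m ⟨Λ_k, G(x)^{⊗k}⟩` with
`λ₀ ≥ 0` and each `Λ_k` positive semidefinite. -/
def HsetT {n : ℕ} {ι : Type*} [Fintype ι]
    (G : Matrix ι ι (MvPolynomial (Fin n) ℝ)) (m : ℕ) : Set (MvPolynomial (Fin n) ℝ) :=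
  { p | ∃ (lam0 : ℝ) (Λ : (k : ℕ) → Matrix (Fin k → ι) (Fin k → ι) ℝ),
      0 ≤ lam0 ∧ (∀ k ∈ Finset.Icc 1 m, (Λ k).PosSemidef) ∧
      p = MvPolynomial.C lam0 + ∑ k ∈ Finset.Icc 1 m, tipP (Λ k) (kronPow G k) }

/-- Entrywise evaluation of a polynomial matrix at a point `x`. -/
def evalMat {n : ℕ} {ι : Type*} (x : Fin n → ℝ)
    (B : Matrix ι ι (MvPolynomial (Fin n) ℝ)) : Matrix ι ι ℝ :=
  Matrix.of fun i j => MvPolynomial.eval x (B i j)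

/-- The set `K_i = {y ∈ ℝ^{I} : G_i(y) ⪰ 0}`, viewed as a subset of `ℝ^{|I|}` (the
coordinates outside `I`, on which `G_i` does not depend, are filled with `0`). -/
def Kres {n qi : ℕ} (I : Finset (Fin n))
    (Gi : Matrix (Fin qi) (Fin qi) (MvPolynomial (Fin n) ℝ)) :
    Set ({j // j ∈ I} → ℝ) :=
  {y | (evalMat (fun j => if h : j ∈ I then y ⟨j, h⟩ else 0) Gi).PosSemidef}

/-- An archimedean subsemiring (preprime) of a real algebra containing the nonnegative constants. -/
structure IsArchimedeanPreprime {A : Type*} [CommRing A] [Algebra ℝ A] (S : Set A) : Prop where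
  add : ∀ {x y}, x ∈ S → y ∈ S → x + y ∈ S
  mul : ∀ {x y}, x ∈ S → y ∈ S → x * y ∈ S
  const : ∀ {c : ℝ}, 0 ≤ c → algebraMap ℝ A c ∈ S
  bound : ∀ a, ∃ N : ℝ, algebraMap ℝ A N + a ∈ S

/-- The states (normalized positive functionals) of a subset of a real algebra. -/
def stateSet {A : Type*} [CommRing A] [Algebra ℝ A] (S : Set A) : Set (A → ℝ) :=
  {L | (∀ x y, L (x + y) = L x + L y) ∧ (∀ (c : ℝ) x, L (c • x) = c * L x) ∧
    (∀ s ∈ S, 0 ≤ L s) ∧ L 1 = 1}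

namespace IsArchimedeanPreprime

variable {A : Type*} [CommRing A] [Algebra ℝ A] {S : Set A}

theorem smul_mem (hS : IsArchimedeanPreprime S) {c : ℝ} (hc : 0 ≤ c) {x : A} (hx : x ∈ S) :
    c • x ∈ S := by
  rw [Algebra.smul_def]
  exact hS.mul (hS.const hc) hx

theorem exists_state_nonpos (hS : IsArchimedeanPreprime S) {a : A} (ha : a ∉ S) :
    ∃ L ∈ stateSet S, L a ≤ 0 := by
  have h10 : (1 : A) ≠ 0 := by
    intro h
    have hsub : Subsingleton A := subsingleton_of_zero_eq_one h.symm
    exact ha (Subsingleton.elim (algebraMap ℝ A 0) a ▸ hS.const le_rfl)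
  let C : PointedCone ℝ A :=
    { carrier := {x | ∃ s ∈ S, ∃ t : ℝ, 0 ≤ t ∧ x = s - t • a}
      add_mem' := by
        rintro _ _ ⟨s, hs, t, ht, rfl⟩ ⟨s', hs', t', ht', rfl⟩
        exact ⟨s + s', hS.add hs hs', t + t', add_nonneg ht ht', by module⟩
      zero_mem' := ⟨algebraMap ℝ A 0, hS.const le_rfl, 0, le_rfl, by simp⟩
      smul_mem' := by
        rintro ⟨c, hc⟩ _ ⟨s, hs, t, ht, rfl⟩
        refine ⟨c • s, hS.smul_mem hc hs, c * t, mul_nonneg hc ht, ?_⟩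
        change c • (s - t • a) = _
        simp only [smul_sub, smul_smul] }
  obtain ⟨g, hg, hgC⟩ := riesz_extension C (LinearPMap.mkSpanSingleton (K := ℝ) (1 : A) (1 : ℝ) h10)
    (by
      rintro ⟨x, hx⟩ hxC
      obtain ⟨c, rfl⟩ := Submodule.mem_span_singleton.1 hx
      rw [LinearPMap.mkSpanSingleton'_apply]
      obtain ⟨s, hs, t, ht, hst⟩ := hxC
      simp only [smul_eq_mul, mul_one, RingHom.id_apply] at hst ⊢
      by_contra! hc
      have hc0 : c ≠ 0 := hc.ne
      rcases ht.eq_or_lt with rfl | ht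
      · obtain ⟨N, hN⟩ := hS.bound a
        rw [zero_smul, sub_zero] at hst
        apply ha
        have hneg : algebraMap ℝ A (-c)⁻¹ * s = algebraMap ℝ A (-1) := by
          rw [← hst, ← Algebra.smul_def, smul_smul, Algebra.algebraMap_eq_smul_one]
          congr 1
          field_simp
        have h1 : algebraMap ℝ A (-1) ∈ S :=
          hneg ▸ hS.mul (hS.const (by rw [inv_nonneg]; linarith)) hs
        have h2 := hS.add (hS.smul_mem (abs_nonneg N) h1)
          (hS.add hN (hS.const (c := |N| - N) (sub_nonneg.2 (le_abs_self N))))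
        convert h2 using 1
        simp only [Algebra.algebraMap_eq_smul_one]
        module
      · apply ha
        have h1 := hS.smul_mem (c := t⁻¹) (by positivity)
          (hS.add hs (hS.const (c := -c) (by linarith)))
        have h2 : t • a = s + algebraMap ℝ A (-c) := by
          rw [Algebra.algebraMap_eq_smul_one, neg_smul]
          rw [hst]; abel
        rwa [← h2, smul_smul, inv_mul_cancel₀ ht.ne', one_smul] at h1)
    (by
      intro y
      obtain ⟨N, hN⟩ := hS.bound y
      refine ⟨⟨N • 1, Submodule.mem_span_singleton.2 ⟨N, rfl⟩⟩, algebraMap ℝ A N + y, hN, 0,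
        le_rfl, ?_⟩
      rw [Algebra.algebraMap_eq_smul_one]; simp)
  have hgS : ∀ s ∈ S, 0 ≤ g s := fun s hs => hgC s ⟨s, hs, 0, le_rfl, by simp⟩
  refine ⟨g, ⟨fun x y => map_add g x y, fun c x => by simp, hgS, ?_⟩, ?_⟩
  · have h := hg ⟨1, Submodule.mem_span_singleton_self 1⟩
    rwa [LinearPMap.mkSpanSingleton_apply] at h
  · have h := hgC (-a) ⟨algebraMap ℝ A 0, hS.const le_rfl, 1, zero_le_one, by simp⟩
    rw [map_neg] at h
    linarith

theorem state_algebraMap {L : A → ℝ} (hL : L ∈ stateSet S) (c : ℝ) : L (algebraMap ℝ A c) = c := by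
  rw [Algebra.algebraMap_eq_smul_one, hL.2.1, hL.2.2.2, mul_one]

theorem isCompact_stateSet (hS : IsArchimedeanPreprime S) : IsCompact (stateSet S) := by
  choose N hN using hS.bound
  have hcl : IsClosed (stateSet S) := by
    have h : stateSet S = (⋂ (x : A) (y : A), {L : A → ℝ | L (x + y) = L x + L y}) ∩
        ((⋂ (c : ℝ) (x : A), {L : A → ℝ | L (c • x) = c * L x}) ∩
        ((⋂ s ∈ S, {L : A → ℝ | 0 ≤ L s}) ∩ {L : A → ℝ | L 1 = 1})) := by
      ext L; simp [stateSet]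
    rw [h]
    refine IsClosed.inter ?_ (IsClosed.inter ?_ (IsClosed.inter ?_ ?_))
    · exact isClosed_iInter fun x => isClosed_iInter fun y =>
        isClosed_eq (by fun_prop) (by fun_prop)
    · exact isClosed_iInter fun c => isClosed_iInter fun x =>
        isClosed_eq (by fun_prop) (by fun_prop)
    · exact isClosed_biInter fun s _ => isClosed_le (by fun_prop) (by fun_prop)
    · exact isClosed_eq (by fun_prop) (by fun_prop)
  refine (isCompact_univ_pi fun a => isCompact_Icc (a := -N a) (b := N (-a))).of_isClosed_subset
    hcl fun L hL a _ => ?_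
  have h1 := hL.2.2.1 _ (hN a)
  have h2 := hL.2.2.1 _ (hN (-a))
  have h3 : L (-a) = - L a := by
    have := hL.2.1 (-1) a
    rwa [neg_one_smul, neg_one_mul] at this
  rw [hL.1, state_algebraMap hL] at h1 h2
  constructor <;> linarith

theorem state_mul_eq_zero (hS : IsArchimedeanPreprime S) {L : A → ℝ} (hL : L ∈ stateSet S) {s : A}
    (hs : s ∈ S) (h0 : L s = 0) (b : A) : L (s * b) = 0 := by
  have key : ∀ b, 0 ≤ L (s * b) := fun b => by
    obtain ⟨N, hN⟩ := hS.bound b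
    have h := hL.2.2.1 _ (hS.mul hs hN)
    rw [mul_add, hL.1, mul_comm s, ← Algebra.smul_def, hL.2.1, h0] at h
    linarith
  have h1 := key (-b)
  have h3 : L (s * -b) = - L (s * b) := by
    have := hL.2.1 (-1) (s * b)
    rwa [neg_one_smul, neg_one_mul, ← mul_neg] at this
  linarith [key b]

theorem extreme_state_mul_of_mem (hS : IsArchimedeanPreprime S) {L : A → ℝ}
    (hL : L ∈ (stateSet S).extremePoints ℝ) {s : A} (hs : s ∈ S) (hs' : 1 - s ∈ S) (b : A) :
    L (s * b) = L s * L b := by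
  have hLs := hL.1
  have hsub : L (1 - s) = 1 - L s := by
    have := hLs.1 (1 - s) s
    rw [sub_add_cancel, hLs.2.2.2] at this
    linarith
  have hsum : ∀ x, L (s * x) + L ((1 - s) * x) = L x := fun x => by
    rw [← hLs.1]; congr 1; ring
  have h0 := hLs.2.2.1 s hs
  have h1 := hLs.2.2.1 _ hs'
  rw [hsub] at h1
  rcases h0.eq_or_lt with h0 | h0
  · rw [hS.state_mul_eq_zero hLs hs h0.symm, ← h0, zero_mul]
  rcases h1.eq_or_lt with h1 | h1
  · have := hS.state_mul_eq_zero hLs hs' (by rw [hsub, h1]) b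
    have h2 := hsum b
    have h3 : L s = 1 := by linarith
    rw [h3]; linarith
  have mk : ∀ u ∈ S, 0 < L u → (fun x => (L u)⁻¹ * L (u * x)) ∈ stateSet S := by
    intro u hu hpos
    refine ⟨fun x y => ?_, fun c x => ?_, fun x hx => ?_, ?_⟩
    · simp only [mul_add, hLs.1]
    · simp only [mul_smul_comm, hLs.2.1]; ring
    · exact mul_nonneg (inv_nonneg.2 hpos.le) (hLs.2.2.1 _ (hS.mul hu hx))
    · simp only [mul_one]; exact inv_mul_cancel₀ hpos.ne'
  have h := hL.2 (mk s hs h0) (mk (1 - s) hs' (by rwa [hsub]))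
    ⟨L s, 1 - L s, h0, h1, by ring, by
      funext x
      simp only [Pi.add_apply, Pi.smul_apply, smul_eq_mul, hsub]
      rw [mul_inv_cancel_left₀ h0.ne', mul_inv_cancel_left₀ h1.ne', hsum]⟩
  have hb := congrFun h b
  rw [← hb, mul_inv_cancel_left₀ h0.ne']

theorem extreme_state_mul (hS : IsArchimedeanPreprime S) {L : A → ℝ}
    (hL : L ∈ (stateSet S).extremePoints ℝ) (x b : A) : L (x * b) = L x * L b := by
  obtain ⟨N₁, h₁⟩ := hS.bound x
  obtain ⟨N₂, h₂⟩ := hS.bound (-x)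
  set N : ℝ := |N₁| + |N₂| + 1 with hN
  have hNpos : 0 < N := by positivity
  have hN₁ : 0 ≤ N - N₁ := by linarith [le_abs_self N₁, abs_nonneg N₂]
  have hN₂ : 0 ≤ N - N₂ := by linarith [le_abs_self N₂, abs_nonneg N₁]
  have hc : 0 ≤ (2 * N)⁻¹ := by positivity
  have hs : (2 * N)⁻¹ • (N • (1 : A) + x) ∈ S := by
    convert hS.smul_mem hc (hS.add (hS.const hN₁) h₁) using 1
    simp only [Algebra.algebraMap_eq_smul_one]
    module
  have hs' : 1 - (2 * N)⁻¹ • (N • (1 : A) + x) ∈ S := by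
    convert hS.smul_mem hc (hS.add (hS.const hN₂) h₂) using 1
    simp only [Algebra.algebraMap_eq_smul_one]
    rw [← sub_eq_zero]
    have h1 : (1 : A) = ((2 * N)⁻¹ * (2 * N)) • (1 : A) := by
      rw [inv_mul_cancel₀ (by positivity), one_smul]
    nth_rewrite 1 [h1]
    module
  have h := hS.extreme_state_mul_of_mem hL hs hs' b
  have hLs := hL.1
  rw [smul_mul_assoc, add_mul, smul_mul_assoc, one_mul] at h
  simp only [hLs.2.1, hLs.1, hLs.2.2.2] at h
  field_simp at h
  linarith

/-- The Kadison–Dubois representation theorem in the form of a Positivstellensatz: an element that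
is positive at every real character nonnegative on an archimedean preprime lies in it. -/
theorem mem_of_forall_character_pos (hS : IsArchimedeanPreprime S) {a : A}
    (h : ∀ φ : A →ₐ[ℝ] ℝ, (∀ s ∈ S, 0 ≤ φ s) → 0 < φ a) : a ∈ S := by
  by_contra ha
  obtain ⟨L₀, hL₀, hL₀a⟩ := hS.exists_state_nonpos ha
  have hcont : Continuous fun L : A → ℝ => L a := continuous_apply a
  obtain ⟨M, hM, hmin⟩ := hS.isCompact_stateSet.exists_isMinOn ⟨L₀, hL₀⟩ hcont.continuousOn
  have hmin' : ∀ L ∈ stateSet S, M a ≤ L a := fun L hL => hmin hL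
  have hF : IsCompact (stateSet S ∩ {L | L a ≤ M a}) :=
    hS.isCompact_stateSet.inter_right (isClosed_le hcont continuous_const)
  obtain ⟨L, hLF, hLext⟩ := hF.extremePoints_nonempty ⟨M, hM, le_refl (M a)⟩
  have hL : L ∈ (stateSet S).extremePoints ℝ := by
    refine ⟨hLF.1, fun L₁ h₁ L₂ h₂ hseg => ?_⟩
    have hLa : L a ≤ M a := hLF.2
    have h1 := hmin' _ h₁
    have h2 := hmin' _ h₂
    obtain ⟨u, v, hu, hv, huv, huvL⟩ := id hseg
    have hcomb : u * L₁ a + v * L₂ a = L a := by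
      rw [← huvL]; simp
    refine hLext ⟨h₁, ?_⟩ ⟨h₂, ?_⟩ hseg
    · change L₁ a ≤ M a
      have hv' : v = 1 - u := by linarith
      subst hv'
      nlinarith
    · change L₂ a ≤ M a
      have hv' : u = 1 - v := by linarith
      subst hv'
      nlinarith
  let φ : A →ₐ[ℝ] ℝ :=
    AlgHom.ofLinearMap ⟨⟨L, hL.1.1⟩, fun c x => hL.1.2.1 c x⟩ hL.1.2.2.2 (hS.extreme_state_mul hL)
  have hφ : 0 < L a := h φ hL.1.2.2.1
  have hLa : L a ≤ M a := hLF.2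
  linarith [hmin' _ hL₀]

end IsArchimedeanPreprime

theorem eventually_forall_fiber_lt {X Z : Type*} [TopologicalSpace X] [TopologicalSpace Z]
    [T2Space Z] {P : Set X} (hP : IsCompact P) {π : X → Z} (hπ : Continuous π) {u : X → ℝ}
    (hu : Continuous u) {c : ℝ} {z : Z} (h : ∀ x ∈ P, π x = z → c < u x) :
    ∀ᶠ z' in nhds z, ∀ x ∈ P, π x = z' → c < u x := by
  have hcl : IsClosed (π '' (P ∩ {x | u x ≤ c})) :=
    ((hP.inter_right (isClosed_le hu continuous_const)).image hπ).isClosed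
  have hz : z ∈ (π '' (P ∩ {x | u x ≤ c}))ᶜ := by
    rintro ⟨x, ⟨hx, hxc⟩, rfl⟩
    exact (h x hx rfl).not_ge hxc
  filter_upwards [hcl.isOpen_compl.mem_nhds hz] with z' hz' x hx hxz
  by_contra! hc
  exact hz' ⟨x, ⟨hx, hc⟩, hxz⟩

/-- Two continuous functions on compact sets fibred over `Z` which are strictly ordered along
fibres can be separated by a continuous function on `Z`. -/
theorem exists_continuous_between_fibers {X Y Z : Type*} [TopologicalSpace X] [TopologicalSpace Y]
    [TopologicalSpace Z] [T2Space Z] [NormalSpace Z] [ParacompactSpace Z]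
    {P : Set X} (hP : IsCompact P) {Q : Set Y} (hQ : IsCompact Q) {π : X → Z} (hπ : Continuous π)
    {ρ : Y → Z} (hρ : Continuous ρ) {u : X → ℝ} (hu : Continuous u) {v : Y → ℝ}
    (hv : Continuous v) (h : ∀ x ∈ P, ∀ y ∈ Q, π x = ρ y → v y < u x) :
    ∃ g : C(Z, ℝ), (∀ x ∈ P, g (π x) < u x) ∧ ∀ y ∈ Q, v y < g (ρ y) := by
  obtain ⟨g, hg⟩ := exists_continuous_forall_mem_convex_of_local_const
    (t := fun z : Z => {c : ℝ | (∀ x ∈ P, π x = z → c < u x) ∧ ∀ y ∈ Q, ρ y = z → v y < c})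
    (by
      intro z
      refine Set.OrdConnected.convex ⟨fun a ha b hb c hc => ⟨fun x hx hxz => ?_, fun y hy hyz => ?_⟩⟩
      · exact hc.2.trans_lt (hb.1 x hx hxz)
      · exact (ha.2 y hy hyz).trans_le hc.1)
    (by
      intro z
      have hPz : IsCompact (P ∩ {x | π x = z}) :=
        hP.inter_right (isClosed_eq hπ continuous_const)
      have hQz : IsCompact (Q ∩ {y | ρ y = z}) :=
        hQ.inter_right (isClosed_eq hρ continuous_const)
      have hc : ∃ c, (∀ x ∈ P, π x = z → c < u x) ∧ ∀ y ∈ Q, ρ y = z → v y < c := by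
        rcases (P ∩ {x | π x = z}).eq_empty_or_nonempty with hPe | hPne
        · rcases (Q ∩ {y | ρ y = z}).eq_empty_or_nonempty with hQe | hQne
          · exact ⟨0, fun x hx hxz => (Set.eq_empty_iff_forall_notMem.1 hPe x ⟨hx, hxz⟩).elim,
              fun y hy hyz => (Set.eq_empty_iff_forall_notMem.1 hQe y ⟨hy, hyz⟩).elim⟩
          · obtain ⟨y₀, -, hmax⟩ := hQz.exists_isMaxOn hQne hv.continuousOn
            exact ⟨v y₀ + 1,
              fun x hx hxz => (Set.eq_empty_iff_forall_notMem.1 hPe x ⟨hx, hxz⟩).elim,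
              fun y hy hyz => (hmax (show y ∈ _ from ⟨hy, hyz⟩)).trans_lt (lt_add_one _)⟩
        · obtain ⟨x₀, hx₀, hmin⟩ := hPz.exists_isMinOn hPne hu.continuousOn
          rcases (Q ∩ {y | ρ y = z}).eq_empty_or_nonempty with hQe | hQne
          · exact ⟨u x₀ - 1,
              fun x hx hxz => (sub_one_lt _).trans_le (hmin (show x ∈ _ from ⟨hx, hxz⟩)),
              fun y hy hyz => (Set.eq_empty_iff_forall_notMem.1 hQe y ⟨hy, hyz⟩).elim⟩
          · obtain ⟨y₀, hy₀, hmax⟩ := hQz.exists_isMaxOn hQne hv.continuousOn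
            obtain ⟨c, hc₁, hc₂⟩ :=
              exists_between (h x₀ hx₀.1 y₀ hy₀.1 (hx₀.2.trans hy₀.2.symm))
            exact ⟨c, fun x hx hxz => hc₂.trans_le (hmin (show x ∈ _ from ⟨hx, hxz⟩)),
              fun y hy hyz => (hmax (show y ∈ _ from ⟨hy, hyz⟩)).trans_lt hc₁⟩
      obtain ⟨c, hc₁, hc₂⟩ := hc
      refine ⟨c, ?_⟩
      have h₂ := eventually_forall_fiber_lt hQ hρ hv.neg (c := -c) (z := z)
        (fun y hy hyz => neg_lt_neg (hc₂ y hy hyz))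
      filter_upwards [eventually_forall_fiber_lt hP hπ hu hc₁, h₂] with z' h1 h2
      exact ⟨h1, fun y hy hyz => neg_lt_neg_iff.1 (h2 y hy hyz)⟩)
  exact ⟨g, fun x hx => (hg (π x)).1 x hx rfl, fun y hy => (hg (ρ y)).2 y hy rfl⟩

/-- Multivariate Weierstrass approximation on compact sets. -/
theorem exists_mvPolynomial_near {σ : Type*} (g : C(σ → ℝ, ℝ)) {K : Set (σ → ℝ)}
    (hK : IsCompact K) {ε : ℝ} (hε : 0 < ε) :
    ∃ p : MvPolynomial σ ℝ, ∀ x ∈ K, |MvPolynomial.eval x p - g x| < ε := by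
  let A : Subalgebra ℝ C(σ → ℝ, ℝ) :=
    (MvPolynomial.aeval fun j => (⟨fun x => x j, continuous_apply j⟩ : C(σ → ℝ, ℝ))).range
  have happ : ∀ (p : MvPolynomial σ ℝ) (x : σ → ℝ),
      (MvPolynomial.aeval fun j => (⟨fun x => x j, continuous_apply j⟩ : C(σ → ℝ, ℝ))) p x =
        MvPolynomial.eval x p := by
    intro p x
    induction p using MvPolynomial.induction_on with
    | C a => simp
    | add p q hp hq => simp [hp, hq]
    | mul_X p j hp => simp [hp]
  have hA : A.SeparatesPoints := by
    intro x y hxy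
    obtain ⟨j, hj⟩ := Function.ne_iff.1 hxy
    refine ⟨_, ⟨_, ⟨MvPolynomial.X j, rfl⟩, rfl⟩, ?_⟩
    change (MvPolynomial.aeval _ _ : C(σ → ℝ, ℝ)) x ≠ (MvPolynomial.aeval _ _ : C(σ → ℝ, ℝ)) y
    rw [happ, happ]
    simpa using hj
  obtain ⟨_, ⟨p, rfl⟩, hp⟩ :=
    ContinuousMap.exists_mem_subalgebra_near_continuous_of_isCompact_of_separatesPoints hA g hK hε
  refine ⟨p, fun x hx => ?_⟩
  have := hp x hx
  change ‖(MvPolynomial.aeval _ p : C(σ → ℝ, ℝ)) x - g x‖ < ε at this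
  rwa [happ] at this

theorem IsCompact.exists_pos_le_of_pos {X : Type*} [TopologicalSpace X] {K : Set X}
    (hK : IsCompact K) {u : X → ℝ} (hu : Continuous u) (h : ∀ x ∈ K, 0 < u x) :
    ∃ ε > 0, ∀ x ∈ K, ε ≤ u x := by
  rcases K.eq_empty_or_nonempty with rfl | hne
  · exact ⟨1, one_pos, by simp⟩
  · obtain ⟨x₀, hx₀, hmin⟩ := hK.exists_isMinOn hne hu.continuousOn
    exact ⟨u x₀, h x₀ hx₀, fun x hx => hmin hx⟩

theorem eval_eq_of_vars_subset {σ : Type*} {p : MvPolynomial σ ℝ} {J : Finset σ}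
    (hp : p.vars ⊆ J) {x y : σ → ℝ} (hxy : ∀ j ∈ J, x j = y j) :
    MvPolynomial.eval x p = MvPolynomial.eval y p :=
  MvPolynomial.eval₂Hom_congr' rfl (fun j hj _ => hxy j (hp hj)) rfl

/-- Setting the variables outside `J` to zero. -/
theorem exists_vars_subset_eval_eq {σ : Type*} [DecidableEq σ] (J : Finset σ)
    (r : MvPolynomial σ ℝ) :
    ∃ p : MvPolynomial σ ℝ, p.vars ⊆ J ∧
      ∀ x, MvPolynomial.eval x p = MvPolynomial.eval (fun j => if j ∈ J then x j else 0) r := by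
  induction r using MvPolynomial.induction_on with
  | C a => exact ⟨MvPolynomial.C a, by simp, by simp⟩
  | add p q hp hq =>
    obtain ⟨p', hp', hpe⟩ := hp
    obtain ⟨q', hq', hqe⟩ := hq
    exact ⟨p' + q', (MvPolynomial.vars_add_subset _ _).trans (Finset.union_subset hp' hq'),
      fun x => by rw [map_add, map_add, hpe, hqe]⟩
  | mul_X p j hp =>
    obtain ⟨p', hp', hpe⟩ := hp
    by_cases hj : j ∈ J
    · exact ⟨p' * MvPolynomial.X j, (MvPolynomial.vars_mul _ _).trans
        (Finset.union_subset hp' (by simpa using hj)), fun x => by simp [hpe, hj]⟩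
    · exact ⟨0, by simp, fun x => by simp [hj]⟩

/-- Two polynomials whose sum is positive on pairs of points sharing their `J`-coordinates can be
corrected by a polynomial in the variables `J` so that each becomes positive. -/
theorem exists_vars_subset_separating {n : ℕ} (J : Finset (Fin n)) {P Q : Set (Fin n → ℝ)}
    (hP : IsCompact P) (hQ : IsCompact Q) (a b : MvPolynomial (Fin n) ℝ)
    (h : ∀ x ∈ P, ∀ y ∈ Q, (∀ j ∈ J, x j = y j) →
      0 < MvPolynomial.eval x a + MvPolynomial.eval y b) :
    ∃ p : MvPolynomial (Fin n) ℝ, p.vars ⊆ J ∧ (∀ x ∈ P, 0 < MvPolynomial.eval x (a - p)) ∧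
      ∀ y ∈ Q, 0 < MvPolynomial.eval y (b + p) := by
  classical
  let π : (Fin n → ℝ) → (Fin n → ℝ) := fun x j => if j ∈ J then x j else 0
  have hπ : Continuous π := by
    refine continuous_pi fun j => ?_
    by_cases hj : j ∈ J
    · simpa [π, hj] using continuous_apply j
    · simpa [π, hj] using continuous_const
  have ha := MvPolynomial.continuous_eval a
  have hb := MvPolynomial.continuous_eval b
  obtain ⟨g, hgP, hgQ⟩ := exists_continuous_between_fibers hP hQ hπ hπ ha hb.neg
    (fun x hx y hy hxy => by
      have := h x hx y hy fun j hj => by simpa [π, hj] using congrFun hxy j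
      change -MvPolynomial.eval y b < _
      linarith)
  obtain ⟨ε₁, hε₁, h₁⟩ := hP.exists_pos_le_of_pos (ha.sub (g.continuous.comp hπ))
    fun x hx => sub_pos.2 (hgP x hx)
  obtain ⟨ε₂, hε₂, h₂⟩ := hQ.exists_pos_le_of_pos (hb.add (g.continuous.comp hπ))
    fun x hx => by
      have : -MvPolynomial.eval x b < g (π x) := hgQ x hx
      change 0 < MvPolynomial.eval x b + g (π x)
      linarith
  obtain ⟨r, hr⟩ := exists_mvPolynomial_near g ((hP.image hπ).union (hQ.image hπ))
    (lt_min hε₁ hε₂)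
  obtain ⟨p, hpJ, hp⟩ := exists_vars_subset_eval_eq J r
  replace hp : ∀ x, MvPolynomial.eval x p = MvPolynomial.eval (π x) r := hp
  refine ⟨p, hpJ, fun x hx => ?_, fun y hy => ?_⟩
  · have h1 := abs_lt.1 (hr (π x) (Or.inl ⟨x, hx, rfl⟩))
    have h2 : ε₁ ≤ MvPolynomial.eval x a - g (π x) := h₁ x hx
    rw [map_sub, hp]
    linarith [min_le_left ε₁ ε₂]
  · have h1 := abs_lt.1 (hr (π y) (Or.inr ⟨y, hy, rfl⟩))
    have h2 : ε₂ ≤ MvPolynomial.eval y b + g (π y) := h₂ y hy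
    rw [map_add, hp]
    linarith [min_le_right ε₁ ε₂]

/-- Decomposition of a positive polynomial with structured sparsity: if `∑ fᵢ` is positive on the
intersection of the cylinders `Kᵢ` and the index sets satisfy the running intersection property,
then the summands can be redistributed so that each is positive on its own `Kᵢ`. -/
theorem exists_sparse_decomposition {n : ℕ} (B : Set (Fin n → ℝ)) :
    ∀ (t : ℕ) (I : Fin t → Finset (Fin n)) (_ : ∀ i : Fin t, 0 < (i : ℕ) →
        ∃ k : Fin t, k < i ∧ ∀ j ∈ I i, ∀ i' < i, j ∈ I i' → j ∈ I k)
      (K : Fin t → Set (Fin n → ℝ)) (_ : ∀ i, K i ⊆ B) (_ : ∀ i, IsCompact (K i))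
      (_ : ∀ i, ∀ x ∈ K i, ∀ y ∈ B, (∀ j ∈ I i, x j = y j) → y ∈ K i)
      (_ : ∀ x ∈ B, ∀ y ∈ B, ∀ J : Finset (Fin n), (fun j => if j ∈ J then x j else y j) ∈ B)
      (f : Fin t → MvPolynomial (Fin n) ℝ) (_ : ∀ i, (f i).vars ⊆ I i)
      (_ : ∀ x, (∀ i, x ∈ K i) → 0 < MvPolynomial.eval x (∑ i, f i)),
      ∃ g : Fin t → MvPolynomial (Fin n) ℝ, (∀ i, (g i).vars ⊆ I i) ∧
        ∑ i, f i = ∑ i, g i ∧ ∀ i, ∀ x ∈ K i, 0 < MvPolynomial.eval x (g i) := by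
  classical
  intro t
  induction t with
  | zero => exact fun I _ K _ _ _ _ f _ _ => ⟨f, fun i => i.elim0, rfl, fun i => i.elim0⟩
  | succ t ih =>
    intro I hI K hKB hK hKI hB f hf hpos
    rcases Nat.eq_zero_or_pos t with rfl | ht
    · have : Subsingleton (Fin (0 + 1)) := inferInstanceAs (Subsingleton (Fin 1))
      refine ⟨f, hf, rfl, fun i x hx => ?_⟩
      have h := hpos x (fun k => by rwa [Subsingleton.elim k i])
      rwa [Fintype.sum_subsingleton _ i] at h
    obtain ⟨k, hk, hRIP⟩ := hI (Fin.last t) ht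
    obtain ⟨k, rfl⟩ := Fin.eq_castSucc_of_ne_last hk.ne
    let U : Finset (Fin n) := Finset.univ.biUnion fun i : Fin t => I i.castSucc
    have hUmem : ∀ i : Fin t, I i.castSucc ⊆ U := fun i =>
      Finset.subset_biUnion_of_mem (fun i : Fin t => I i.castSucc) (Finset.mem_univ i)
    let Q : Set (Fin n → ℝ) := ⋂ i : Fin t, K i.castSucc
    have hQ : IsCompact Q := (hK k.castSucc).of_isClosed_subset
      (isClosed_iInter fun i => (hK i.castSucc).isClosed) (Set.iInter_subset _ k)
    let F : MvPolynomial (Fin n) ℝ := ∑ i : Fin t, f i.castSucc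
    have hF : F.vars ⊆ U := (MvPolynomial.vars_sum_subset _ _).trans
      (Finset.biUnion_mono fun i _ => hf i.castSucc)
    obtain ⟨p, hpJ, hpl, hpQ⟩ := exists_vars_subset_separating (I (Fin.last t) ∩ U)
      (hK (Fin.last t)) hQ (f (Fin.last t)) F (by
        intro x hx y hy hxy
        have hyK : ∀ i : Fin t, y ∈ K i.castSucc := Set.mem_iInter.1 hy
        let w : Fin n → ℝ := fun j => if j ∈ I (Fin.last t) then x j else y j
        have hwB : w ∈ B := hB x (hKB _ hx) y (hKB _ (hyK k)) _
        have hwx : ∀ j ∈ I (Fin.last t), x j = w j := fun j hj => by simp [w, hj]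
        have hwy : ∀ j ∈ U, y j = w j := fun j hj => by
          by_cases hj' : j ∈ I (Fin.last t)
          · simp only [w, hj', if_true]
            exact (hxy j (Finset.mem_inter.2 ⟨hj', hj⟩)).symm
          · simp [w, hj']
        have h := hpos w (fun i => by
          induction i using Fin.lastCases with
          | last => exact hKI _ x hx w hwB hwx
          | cast i => exact hKI _ y (hyK i) w hwB fun j hj => hwy j (hUmem i hj))
        rw [Fin.sum_univ_castSucc, map_add, ← eval_eq_of_vars_subset hF hwy,
          ← eval_eq_of_vars_subset (hf (Fin.last t)) hwx, add_comm] at h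
        exact h)
    have hpk : p.vars ⊆ I k.castSucc := fun j hj => by
      obtain ⟨hj₁, hj₂⟩ := Finset.mem_inter.1 (hpJ hj)
      obtain ⟨i, -, hi⟩ := Finset.mem_biUnion.1 hj₂
      exact hRIP j hj₁ i.castSucc (Fin.castSucc_lt_last i) hi
    have hsum : ∑ i : Fin t, (f i.castSucc + if i = k then p else 0) = F + p := by
      rw [Finset.sum_add_distrib, Finset.sum_ite_eq' Finset.univ k, if_pos (Finset.mem_univ k)]
    obtain ⟨g, hg, hgsum, hgpos⟩ := ih (fun i => I i.castSucc)
      (by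
        intro i hi
        obtain ⟨k', hk', h⟩ := hI i.castSucc hi
        obtain ⟨k', rfl⟩ := Fin.eq_castSucc_of_ne_last (hk'.trans (Fin.castSucc_lt_last i)).ne
        exact ⟨k', Fin.castSucc_lt_castSucc_iff.1 hk', fun j hj i' hi' hj' =>
          h j hj i'.castSucc (Fin.castSucc_lt_castSucc_iff.2 hi') hj'⟩)
      (fun i => K i.castSucc) (fun i => hKB _) (fun i => hK _) (fun i => hKI _) hB
      (fun i => f i.castSucc + if i = k then p else 0)
      (fun i => (MvPolynomial.vars_add_subset _ _).trans (Finset.union_subset (hf _) (by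
        split_ifs with h
        · exact h ▸ hpk
        · simp)))
      (fun x hx => by
        rw [hsum]
        exact hpQ x (Set.mem_iInter.2 hx))
    refine ⟨Fin.lastCases (f (Fin.last t) - p) g, fun i => ?_, ?_, fun i => ?_⟩
    · induction i using Fin.lastCases with
      | last =>
        simp only [Fin.lastCases_last]
        exact (MvPolynomial.vars_sub_subset _).trans
          (Finset.union_subset (hf _) (hpJ.trans Finset.inter_subset_left))
      | cast i => simpa only [Fin.lastCases_castSucc] using hg i
    · rw [Fin.sum_univ_castSucc, Fin.sum_univ_castSucc]
      simp only [Fin.lastCases_last, Fin.lastCases_castSucc]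
      rw [← hgsum, hsum]
      ring
    · induction i using Fin.lastCases with
      | last => simpa only [Fin.lastCases_last] using hpl
      | cast i => simpa only [Fin.lastCases_castSucc] using hgpos i

/-- The untruncated cone `H(G) = ⋃ₘ H_m(G)`. -/
def HsetU {n : ℕ} {ι : Type*} [Fintype ι]
    (G : Matrix ι ι (MvPolynomial (Fin n) ℝ)) : Set (MvPolynomial (Fin n) ℝ) :=
  {p | ∃ m, p ∈ HsetT G m}

theorem Matrix.PosSemidef.kronPow {ι : Type*} [Fintype ι] {M : Matrix ι ι ℝ} (hM : M.PosSemidef) :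
    ∀ k, (_root_.kronPow M k).PosSemidef
  | 0 => by
    classical
    have h : _root_.kronPow M 0 = 1 := by
      ext a b
      simp [_root_.kronPow, Matrix.one_apply, Subsingleton.elim a b]
    rw [h]
    exact Matrix.PosSemidef.one
  | k + 1 => by
    have h : _root_.kronPow M (k + 1) = (Matrix.kronecker M (_root_.kronPow M k)).submatrix
        (fun a => (a 0, Fin.tail a)) (fun a => (a 0, Fin.tail a)) := by
      ext a b
      simp [_root_.kronPow, Fin.prod_univ_succ, Matrix.kroneckerMap_apply, Fin.tail]
    rw [h]
    exact (hM.kronecker (hM.kronPow k)).submatrix _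

theorem Matrix.PosSemidef.sum_mul_nonneg {ι : Type*} [Fintype ι] {A B : Matrix ι ι ℝ}
    (hA : A.PosSemidef) (hB : B.PosSemidef) : 0 ≤ ∑ i, ∑ j, A i j * B i j := by
  have h := (hA.hadamard hB).dotProduct_mulVec_nonneg fun _ => 1
  simpa [dotProduct, Matrix.mulVec, Matrix.hadamard] using h

section tip

variable {n : ℕ} {ι : Type*} [Fintype ι]

theorem eval_tipP_kronPow (x : Fin n → ℝ) (G : Matrix ι ι (MvPolynomial (Fin n) ℝ)) (k : ℕ)
    (Λ : Matrix (Fin k → ι) (Fin k → ι) ℝ) :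
    MvPolynomial.eval x (tipP Λ (kronPow G k)) =
      ∑ a, ∑ b, Λ a b * kronPow (evalMat x G) k a b := by
  simp [tipP, kronPow, evalMat]

theorem tipP_zero (B : Matrix ι ι (MvPolynomial (Fin n) ℝ)) : tipP 0 B = 0 := by
  simp [tipP]

theorem tipP_add (Λ M : Matrix ι ι ℝ) (B : Matrix ι ι (MvPolynomial (Fin n) ℝ)) :
    tipP (Λ + M) B = tipP Λ B + tipP M B := by
  simp [tipP, add_mul, Finset.sum_add_distrib]

theorem tipP_smul (c : ℝ) (Λ : Matrix ι ι ℝ) (B : Matrix ι ι (MvPolynomial (Fin n) ℝ)) :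
    tipP (c • Λ) B = MvPolynomial.C c * tipP Λ B := by
  simp [tipP, Finset.mul_sum, mul_assoc]

theorem tipP_kronPow_mul (G : Matrix ι ι (MvPolynomial (Fin n) ℝ)) (k l : ℕ)
    (Λ : Matrix (Fin k → ι) (Fin k → ι) ℝ) (M : Matrix (Fin l → ι) (Fin l → ι) ℝ) :
    tipP Λ (kronPow G k) * tipP M (kronPow G l) =
      tipP ((Matrix.kronecker Λ M).submatrix (Fin.appendEquiv k l).symm
        (Fin.appendEquiv k l).symm) (kronPow G (k + l)) := by
  simp only [tipP]
  rw [← (Fin.appendEquiv k l).sum_comp, Fintype.sum_prod_type, Finset.sum_mul_sum]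
  refine Finset.sum_congr rfl fun a _ => Finset.sum_congr rfl fun a' _ => ?_
  rw [← (Fin.appendEquiv k l).sum_comp, Fintype.sum_prod_type, Finset.sum_mul_sum]
  refine Finset.sum_congr rfl fun b _ => Finset.sum_congr rfl fun b' _ => ?_
  simp only [Matrix.submatrix_apply, Equiv.symm_apply_apply, Matrix.kronecker,
    Matrix.kroneckerMap_apply, kronPow, Matrix.of_apply, Fin.prod_univ_add, map_mul]
  simp only [Fin.appendEquiv, Equiv.coe_fn_mk, Fin.append_left, Fin.append_right]
  ring

theorem tipP_kronPow_one (G : Matrix ι ι (MvPolynomial (Fin n) ℝ)) (Λ : Matrix ι ι ℝ) :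
    tipP (Λ.submatrix (fun a : Fin 1 → ι => a 0) fun a => a 0) (kronPow G 1) = tipP Λ G := by
  simp only [tipP]
  rw [← (Equiv.funUnique (Fin 1) ι).symm.sum_comp]
  refine Finset.sum_congr rfl fun a _ => ?_
  rw [← (Equiv.funUnique (Fin 1) ι).symm.sum_comp]
  refine Finset.sum_congr rfl fun b _ => ?_
  simp [kronPow]

variable {G : Matrix ι ι (MvPolynomial (Fin n) ℝ)}

theorem HsetT_mono : Monotone (HsetT G) := by
  rintro m m' hm p ⟨c, Λ, hc, hΛ, rfl⟩
  refine ⟨c, fun k => if k ≤ m then Λ k else 0, hc, fun k hk => ?_, ?_⟩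
  · beta_reduce
    split_ifs with h
    · exact hΛ k (Finset.mem_Icc.2 ⟨(Finset.mem_Icc.1 hk).1, h⟩)
    · exact Matrix.PosSemidef.zero
  · congr 1
    rw [← Finset.sum_subset (Finset.Icc_subset_Icc_right hm)]
    · exact Finset.sum_congr rfl fun k hk => by
        beta_reduce
        rw [if_pos (Finset.mem_Icc.1 hk).2]
    · intro k hk hk'
      beta_reduce
      rw [if_neg fun h => hk' (Finset.mem_Icc.2 ⟨(Finset.mem_Icc.1 hk).1, h⟩), tipP_zero]

theorem HsetT_eval_nonneg {m : ℕ} {p : MvPolynomial (Fin n) ℝ} (hp : p ∈ HsetT G m)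
    {x : Fin n → ℝ} (hx : (evalMat x G).PosSemidef) : 0 ≤ MvPolynomial.eval x p := by
  obtain ⟨c, Λ, hc, hΛ, rfl⟩ := hp
  rw [map_add, MvPolynomial.eval_C, map_sum]
  refine add_nonneg hc (Finset.sum_nonneg fun k hk => ?_)
  rw [eval_tipP_kronPow]
  exact (hΛ k hk).sum_mul_nonneg (hx.kronPow k)

theorem C_mem_HsetT {c : ℝ} (hc : 0 ≤ c) (m : ℕ) : MvPolynomial.C c ∈ HsetT G m :=
  ⟨c, 0, hc, fun _ _ => Matrix.PosSemidef.zero, by simp [tipP_zero]⟩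

theorem HsetU_add {p r : MvPolynomial (Fin n) ℝ} (hp : p ∈ HsetU G) (hr : r ∈ HsetU G) :
    p + r ∈ HsetU G := by
  obtain ⟨m₁, hp⟩ := hp
  obtain ⟨m₂, hr⟩ := hr
  obtain ⟨c, Λ, hc, hΛ, rfl⟩ := HsetT_mono (le_max_left m₁ m₂) hp
  obtain ⟨d, M, hd, hM, rfl⟩ := HsetT_mono (le_max_right m₁ m₂) hr
  refine ⟨max m₁ m₂, c + d, fun k => Λ k + M k, add_nonneg hc hd,
    fun k hk => (hΛ k hk).add (hM k hk), ?_⟩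
  simp only [tipP_add, Finset.sum_add_distrib, map_add]
  ring

theorem tipP_kronPow_mem_HsetU {k : ℕ} (hk : 1 ≤ k) {Λ : Matrix (Fin k → ι) (Fin k → ι) ℝ}
    (hΛ : Λ.PosSemidef) : tipP Λ (kronPow G k) ∈ HsetU G := by
  classical
  refine ⟨k, 0, Function.update (fun _ => 0) k Λ, le_rfl, fun l _ => ?_, ?_⟩
  · rcases eq_or_ne l k with rfl | h
    · rwa [Function.update_self]
    · rw [Function.update_of_ne h]
      exact Matrix.PosSemidef.zero
  · rw [map_zero, zero_add, Finset.sum_eq_single k]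
    · rw [Function.update_self]
    · intro l _ h
      rw [Function.update_of_ne h, tipP_zero]
    · intro h
      exact (h (Finset.mem_Icc.2 ⟨hk, le_rfl⟩)).elim

theorem tipP_mem_HsetU {Λ : Matrix ι ι ℝ} (hΛ : Λ.PosSemidef) : tipP Λ G ∈ HsetU G := by
  rw [← tipP_kronPow_one]
  exact tipP_kronPow_mem_HsetU le_rfl (hΛ.submatrix _)

theorem HsetU_induction {P : MvPolynomial (Fin n) ℝ → Prop}
    (const : ∀ c : ℝ, 0 ≤ c → P (MvPolynomial.C c))
    (tip : ∀ (k : ℕ) (Λ : Matrix (Fin k → ι) (Fin k → ι) ℝ), 1 ≤ k → Λ.PosSemidef →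
      P (tipP Λ (kronPow G k)))
    (add : ∀ p r, P p → P r → P (p + r)) {p : MvPolynomial (Fin n) ℝ} (hp : p ∈ HsetU G) :
    P p := by
  obtain ⟨m, c, Λ, hc, hΛ, rfl⟩ := hp
  refine add _ _ (const c hc) (Finset.sum_induction _ P add ?_ fun k hk =>
    tip k _ (Finset.mem_Icc.1 hk).1 (hΛ k hk))
  simpa using const 0 le_rfl

theorem HsetU_C_mul {c : ℝ} (hc : 0 ≤ c) {p : MvPolynomial (Fin n) ℝ} (hp : p ∈ HsetU G) :
    MvPolynomial.C c * p ∈ HsetU G := by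
  refine HsetU_induction (P := fun p => MvPolynomial.C c * p ∈ HsetU G) (fun d hd => ?_)
    (fun k Λ hk hΛ => ?_) (fun p r hp hr => ?_) hp
  · rw [← map_mul]
    exact ⟨0, C_mem_HsetT (mul_nonneg hc hd) 0⟩
  · rw [← tipP_smul]
    exact tipP_kronPow_mem_HsetU hk (hΛ.smul hc)
  · rw [mul_add]
    exact HsetU_add hp hr

theorem HsetU_mul {p r : MvPolynomial (Fin n) ℝ} (hp : p ∈ HsetU G) (hr : r ∈ HsetU G) :
    p * r ∈ HsetU G := by
  refine HsetU_induction (P := fun p => p * r ∈ HsetU G) (fun c hc => HsetU_C_mul hc hr)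
    (fun k Λ hk hΛ => ?_) (fun p s hp hs => ?_) hp
  · refine HsetU_induction (P := fun r => tipP Λ (kronPow G k) * r ∈ HsetU G) (fun c hc => ?_)
      (fun l M hl hM => ?_) (fun p s hp hs => ?_) hr
    · rw [mul_comm]
      exact HsetU_C_mul hc (tipP_kronPow_mem_HsetU hk hΛ)
    · rw [tipP_kronPow_mul]
      exact tipP_kronPow_mem_HsetU (hk.trans (Nat.le_add_right k l))
        ((hΛ.kronecker hM).submatrix _)
    · rw [mul_add]
      exact HsetU_add hp hs
  · rw [add_mul]
    exact HsetU_add hp hs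

end tip

/-- In a finite-dimensional space, a convex cone which is not everything lies in a half-space. -/
theorem PointedCone.exists_ne_zero_nonneg {E : Type*} [NormedAddCommGroup E] [NormedSpace ℝ E]
    [FiniteDimensional ℝ E] (C : PointedCone ℝ E) {x : E} (hx : x ∉ C) :
    ∃ f : E →ₗ[ℝ] ℝ, f ≠ 0 ∧ ∀ c ∈ C, 0 ≤ f c := by
  have hconv : Convex ℝ (C : Set E) := by
    intro a ha b hb s t hs ht _
    exact C.add_mem (C.smul_mem hs ha) (C.smul_mem ht hb)
  by_cases hspan : Submodule.span ℝ (C : Set E) = ⊤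
  · have hint : (interior (C : Set E)).Nonempty := by
      rw [hconv.interior_nonempty_iff_affineSpan_eq_top]
      have h := affineSpan_insert_zero (k := ℝ) (C : Set E)
      rw [Set.insert_eq_of_mem (show (0 : E) ∈ (C : Set E) from C.zero_mem), hspan] at h
      exact SetLike.coe_injective (by simpa using h)
    obtain ⟨f, hf, hfC⟩ := geometric_hahn_banach_of_nonempty_interior_point hconv
      (fun h => hx (interior_subset h)) hint
    refine ⟨-(f : E →ₗ[ℝ] ℝ), ?_, fun c hc => ?_⟩
    · intro h
      apply hf
      ext y
      simpa using LinearMap.congr_fun h y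
    · by_contra! hneg
      have hpos : 0 < f c := by simpa using hneg
      have hfx : 0 ≤ f x := by simpa using hfC 0 C.zero_mem
      have h := hfC _ (C.smul_mem (show 0 ≤ (f x + 1) / f c by positivity) hc)
      change f (((f x + 1) / f c) • c) ≤ f x at h
      rw [map_smul, smul_eq_mul, div_mul_cancel₀ _ hpos.ne'] at h
      linarith
  · obtain ⟨f, hf, hle⟩ := Submodule.exists_le_ker_of_lt_top _ (lt_top_iff_ne_top.2 hspan)
    exact ⟨f, hf, fun c hc => (LinearMap.mem_ker.1 (hle (Submodule.subset_span hc))).ge⟩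

theorem MvPolynomial.eq_affine_of_totalDegree_le_one {σ : Type*} [Fintype σ]
    {p : MvPolynomial σ ℝ} (hp : p.totalDegree ≤ 1) :
    p = C (coeff 0 p) + ∑ j, C (coeff (Finsupp.single j 1) p) * X j := by
  classical
  ext m
  simp only [coeff_add, coeff_C, coeff_sum, coeff_C_mul, coeff_X, mul_ite, mul_one, mul_zero]
  rcases lt_or_ge 1 (Finsupp.degree m) with h | h
  · rw [coeff_eq_zero_of_totalDegree_lt (hp.trans_lt h), if_neg, zero_add, Finset.sum_eq_zero]
    · intro j _
      rw [if_neg]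
      rintro rfl
      simp at h
    · rintro rfl
      simp at h
  · rcases Nat.le_one_iff_eq_zero_or_eq_one.1 h with h | h
    · rw [Finsupp.degree_eq_zero_iff] at h
      subst h
      simp
    · obtain ⟨i, rfl⟩ := Finsupp.range_single_one.ge h
      rw [if_neg (by intro h; simpa using h.symm), zero_add, Finset.sum_eq_single i]
      · simp
      · intro j _ hj
        rw [if_neg (fun h => hj (Finsupp.single_left_injective one_ne_zero h))]
      · simp

/-- Extension by zero of a point of `ℝ^I`. -/
def extendZero {n : ℕ} (I : Finset (Fin n)) (y : {j // j ∈ I} → ℝ) : Fin n → ℝ :=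
  fun j => if h : j ∈ I then y ⟨j, h⟩ else 0

theorem extendZero_coe {n : ℕ} {I : Finset (Fin n)} (y : {j // j ∈ I} → ℝ) (j : {j // j ∈ I}) :
    extendZero I y j = y j := by
  simp [extendZero]

theorem eq_affine_of_vars_subset {n : ℕ} {I : Finset (Fin n)} {p : MvPolynomial (Fin n) ℝ}
    (hp : p.totalDegree ≤ 1) (hv : p.vars ⊆ I) :
    p = MvPolynomial.C (MvPolynomial.coeff 0 p) + ∑ j : {j // j ∈ I},
      MvPolynomial.C (MvPolynomial.coeff (Finsupp.single (j : Fin n) 1) p) *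
        MvPolynomial.X (j : Fin n) := by
  conv_lhs => rw [MvPolynomial.eq_affine_of_totalDegree_le_one hp]
  congr 1
  rw [Finset.sum_coe_sort I fun j => MvPolynomial.C (MvPolynomial.coeff (Finsupp.single j 1) p) *
    (MvPolynomial.X j : MvPolynomial (Fin n) ℝ)]
  refine (Finset.sum_subset (Finset.subset_univ I) fun j _ hj => ?_).symm
  have h : MvPolynomial.coeff (Finsupp.single j 1) p = 0 := by
    by_contra h
    exact hj (hv ((MvPolynomial.mem_vars_iff_mem_support j).2
      ⟨_, MvPolynomial.mem_support_iff.2 h, by simp⟩))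
  rw [h, map_zero, zero_mul]

section spectrahedron

variable {n q : ℕ} {I : Finset (Fin n)} {G : Matrix (Fin q) (Fin q) (MvPolynomial (Fin n) ℝ)}

theorem eval_extendZero_affine {p : MvPolynomial (Fin n) ℝ} (hp : p.totalDegree ≤ 1)
    (hv : p.vars ⊆ I) (y : {j // j ∈ I} → ℝ) :
    MvPolynomial.eval (extendZero I y) p = MvPolynomial.coeff 0 p +
      ∑ j : {j // j ∈ I}, MvPolynomial.coeff (Finsupp.single (j : Fin n) 1) p * y j := by
  conv_lhs => rw [eq_affine_of_vars_subset hp hv]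
  simp only [map_add, map_sum, map_mul, MvPolynomial.eval_C, MvPolynomial.eval_X, extendZero_coe]

theorem posSemidef_of_forall_sum_nonneg {ι : Type*} [Fintype ι] {M : Matrix ι ι ℝ} (hM : M.IsSymm)
    (h : ∀ u : ι → ℝ, 0 ≤ ∑ a, ∑ b, u a * u b * M a b) : M.PosSemidef := by
  refine Matrix.PosSemidef.of_dotProduct_mulVec_nonneg ?_ fun u => ?_
  · rw [Matrix.IsHermitian, Matrix.conjTranspose_eq_transpose_of_trivial, hM]
  · refine (h u).trans_eq ?_
    simp only [dotProduct, Matrix.mulVec, star_trivial, Finset.mul_sum]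
    exact Finset.sum_congr rfl fun a _ => Finset.sum_congr rfl fun b _ => by ring

theorem posSemidef_vecMulVec_self {ι : Type*} [Fintype ι] (u : ι → ℝ) :
    (Matrix.vecMulVec u u).PosSemidef := by
  simpa using Matrix.posSemidef_vecMulVec_self_star u

/-- If a spectrahedron is nonempty and bounded, every linear form is the linear part of some
`⟨Λ, G(x)⟩` with `Λ ⪰ 0`. -/
theorem exists_posSemidef_linear_part (hsym : G.IsSymm) (haff : ∀ a b, (G a b).totalDegree ≤ 1)
    (hvars : ∀ a b, (G a b).vars ⊆ I) (hbdd : Bornology.IsBounded (Kres I G))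
    (hne : (Kres I G).Nonempty) (d : {j // j ∈ I} → ℝ) :
    ∃ Λ : Matrix (Fin q) (Fin q) ℝ, Λ.PosSemidef ∧ ∀ j : {j // j ∈ I},
      ∑ a, ∑ b, Λ a b * MvPolynomial.coeff (Finsupp.single (j : Fin n) 1) (G a b) = d j := by
  let g : {j // j ∈ I} → Fin q → Fin q → ℝ := fun j a b =>
    MvPolynomial.coeff (Finsupp.single (j : Fin n) 1) (G a b)
  let D : PointedCone ℝ ({j // j ∈ I} → ℝ) :=
    { carrier := {d | ∃ Λ : Matrix (Fin q) (Fin q) ℝ, Λ.PosSemidef ∧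
        ∀ j, ∑ a, ∑ b, Λ a b * g j a b = d j}
      add_mem' := by
        rintro d d' ⟨Λ, hΛ, h⟩ ⟨M, hM, h'⟩
        refine ⟨Λ + M, hΛ.add hM, fun j => ?_⟩
        simp only [Matrix.add_apply, add_mul, Finset.sum_add_distrib, h, h', Pi.add_apply]
      zero_mem' := ⟨0, Matrix.PosSemidef.zero, fun j => by simp⟩
      smul_mem' := by
        rintro ⟨c, hc⟩ d ⟨Λ, hΛ, h⟩
        refine ⟨c • Λ, hΛ.smul hc, fun j => ?_⟩
        change _ = c * d j
        simp only [Matrix.smul_apply, smul_eq_mul, mul_assoc, ← Finset.mul_sum, h] }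
  by_contra hd
  obtain ⟨φ, hφ, hφD⟩ := D.exists_ne_zero_nonneg (x := d) hd
  set v : {j // j ∈ I} → ℝ := fun j => φ (Pi.single j 1) with hv
  have hφv : ∀ y, φ y = ∑ j, y j * v j := fun y => by
    rw [LinearMap.pi_apply_eq_sum_univ φ y]
    refine Finset.sum_congr rfl fun j _ => ?_
    rw [smul_eq_mul, hv]
    congr 2
    ext i
    simp [Pi.single_apply, eq_comm]
  have hv0 : v ≠ 0 := by
    intro h
    apply hφ
    ext1 j
    ext1
    simpa using congrFun h j
  let M : Matrix (Fin q) (Fin q) ℝ := Matrix.of fun a b => ∑ j, g j a b * v j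
  have hM : M.PosSemidef := by
    refine posSemidef_of_forall_sum_nonneg ?_ fun u => ?_
    · ext a b
      simp only [M, g, Matrix.transpose_apply, Matrix.of_apply, hsym.apply]
    · have h := hφD (fun j => ∑ a, ∑ b, Matrix.vecMulVec u u a b * g j a b)
        ⟨_, posSemidef_vecMulVec_self u, fun j => rfl⟩
      rw [hφv] at h
      refine h.trans_eq ?_
      simp only [M, Matrix.of_apply, Finset.mul_sum, Finset.sum_mul, Matrix.vecMulVec_apply]
      rw [Finset.sum_comm]
      refine Finset.sum_congr rfl fun a _ => ?_
      rw [Finset.sum_comm]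
      exact Finset.sum_congr rfl fun b _ => Finset.sum_congr rfl fun j _ => by ring
  obtain ⟨y₀, hy₀⟩ := hne
  have hray : ∀ s : ℝ, 0 ≤ s → y₀ + s • v ∈ Kres I G := by
    intro s hs
    have h : evalMat (extendZero I (y₀ + s • v)) G = evalMat (extendZero I y₀) G + s • M := by
      ext a b
      simp only [evalMat, Matrix.of_apply, Matrix.add_apply, Matrix.smul_apply, smul_eq_mul, M,
        eval_extendZero_affine (haff a b) (hvars a b), Pi.add_apply, Pi.smul_apply, mul_add,
        Finset.sum_add_distrib, Finset.mul_sum, g, add_assoc]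
      congr 2
      exact Finset.sum_congr rfl fun j _ => by ring
    change (evalMat (extendZero I (y₀ + s • v)) G).PosSemidef
    rw [h]
    exact Matrix.PosSemidef.add hy₀ (hM.smul hs)
  obtain ⟨R, hR⟩ := hbdd.exists_norm_le
  have hvn : 0 < ‖v‖ := norm_pos_iff.2 hv0
  have hR0 : 0 ≤ R := (norm_nonneg _).trans (hR y₀ hy₀)
  have hs : 0 ≤ (R + ‖y₀‖ + 1) / ‖v‖ := by positivity
  have h1 := hR _ (hray _ hs)
  have h2 := norm_sub_le (y₀ + ((R + ‖y₀‖ + 1) / ‖v‖) • v) y₀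
  rw [add_sub_cancel_left, norm_smul, Real.norm_of_nonneg hs, div_mul_cancel₀ _ hvn.ne'] at h2
  linarith

end spectrahedron

theorem MvPolynomial.exists_C_add_mem_and_C_sub_mem {σ : Type*} {S : Set (MvPolynomial σ ℝ)}
    (add : ∀ p ∈ S, ∀ r ∈ S, p + r ∈ S) (mul : ∀ p ∈ S, ∀ r ∈ S, p * r ∈ S)
    (const : ∀ c : ℝ, 0 ≤ c → C c ∈ S)
    (hX : ∀ j, ∃ N : ℝ, C N + X j ∈ S ∧ C N - X j ∈ S) (p : MvPolynomial σ ℝ) :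
    ∃ N : ℝ, C N + p ∈ S ∧ C N - p ∈ S := by
  have half : ∀ p r s : MvPolynomial σ ℝ, p ∈ S → r ∈ S → p + r = C 2 * s → s ∈ S := by
    intro p r s hp hr h
    have h' := mul _ (const (1 / 2) (by norm_num)) _ (add p hp r hr)
    rwa [h, ← mul_assoc, ← C_mul, one_div_mul_cancel two_ne_zero, C_1, one_mul] at h'
  have hC2 : (C 2 : MvPolynomial σ ℝ) = 2 := map_ofNat C 2
  induction p using MvPolynomial.induction_on with
  | C c =>
    refine ⟨|c|, ?_, ?_⟩
    · rw [← C_add]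
      exact const _ (by linarith [neg_abs_le c])
    · rw [← C_sub]
      exact const _ (by linarith [le_abs_self c])
  | add p r hp hr =>
    obtain ⟨N, h₁, h₂⟩ := hp
    obtain ⟨M, h₃, h₄⟩ := hr
    refine ⟨N + M, ?_, ?_⟩
    · convert add _ h₁ _ h₃ using 1
      rw [C_add]
      ring
    · convert add _ h₂ _ h₄ using 1
      rw [C_add]
      ring
  | mul_X p j hp =>
    obtain ⟨N, h₁, h₂⟩ := hp
    obtain ⟨M, h₃, h₄⟩ := hX j
    refine ⟨N * M, ?_, ?_⟩
    · refine half _ _ _ (mul _ h₁ _ h₃) (mul _ h₂ _ h₄) ?_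
      rw [C_mul, hC2]
      ring
    · refine half _ _ _ (mul _ h₁ _ h₄) (mul _ h₂ _ h₃) ?_
      rw [C_mul, hC2]
      ring

section positivstellensatz

variable {n q : ℕ} {I : Finset (Fin n)} {G : Matrix (Fin q) (Fin q) (MvPolynomial (Fin n) ℝ)}

theorem exists_C_add_linear_mem_HsetU (hsym : G.IsSymm) (haff : ∀ a b, (G a b).totalDegree ≤ 1)
    (hvars : ∀ a b, (G a b).vars ⊆ I) (hbdd : Bornology.IsBounded (Kres I G))
    (hne : (Kres I G).Nonempty) (d : {j // j ∈ I} → ℝ) :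
    ∃ N : ℝ, MvPolynomial.C N + ∑ j : {j // j ∈ I}, MvPolynomial.C (d j) *
      MvPolynomial.X (j : Fin n) ∈ HsetU G := by
  obtain ⟨Λ, hΛ, h⟩ := exists_posSemidef_linear_part hsym haff hvars hbdd hne d
  refine ⟨∑ a, ∑ b, Λ a b * MvPolynomial.coeff 0 (G a b), ?_⟩
  convert tipP_mem_HsetU (G := G) hΛ using 1
  have e : ∀ a b, MvPolynomial.C (Λ a b) * G a b =
      MvPolynomial.C (Λ a b * MvPolynomial.coeff 0 (G a b)) + ∑ j : {j // j ∈ I},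
        MvPolynomial.C (Λ a b * MvPolynomial.coeff (Finsupp.single (j : Fin n) 1) (G a b)) *
          MvPolynomial.X (j : Fin n) := by
    intro a b
    conv_lhs => rw [eq_affine_of_vars_subset (haff a b) (hvars a b)]
    simp only [map_mul, mul_add, Finset.mul_sum, mul_assoc]
  simp only [tipP, e, Finset.sum_add_distrib, map_sum]
  congr 1
  simp only [← h, map_sum, Finset.sum_mul]
  rw [Finset.sum_comm]
  exact Finset.sum_congr rfl fun a _ => Finset.sum_comm

/-- **Positivstellensatz for bounded spectrahedra**: a polynomial positive on a bounded nonempty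
spectrahedron `{G ⪰ 0}` lies in the cone `H(G)`. -/
theorem exists_mem_HsetT_of_pos (hsym : G.IsSymm) (haff : ∀ a b, (G a b).totalDegree ≤ 1)
    (hvars : ∀ a b, (G a b).vars ⊆ I) (hbdd : Bornology.IsBounded (Kres I G))
    (hne : (Kres I G).Nonempty) {p : MvPolynomial (Fin n) ℝ} (hp : p.vars ⊆ I)
    (hpos : ∀ y ∈ Kres I G, 0 < MvPolynomial.eval (extendZero I y) p) : ∃ m, p ∈ HsetT G m := by
  classical
  have hrange : ∀ r : MvPolynomial (Fin n) ℝ, r.vars ⊆ I →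
      ∃ r' : MvPolynomial {j // j ∈ I} ℝ, MvPolynomial.rename Subtype.val r' = r := by
    intro r hr
    refine MvPolynomial.exists_rename_eq_of_vars_subset_range r Subtype.val
      Subtype.val_injective fun j hj => ⟨⟨j, hr hj⟩, rfl⟩
  have heval : ∀ (y : {j // j ∈ I} → ℝ) (r : MvPolynomial {j // j ∈ I} ℝ),
      MvPolynomial.eval (extendZero I y) (MvPolynomial.rename Subtype.val r) =
        MvPolynomial.eval y r := by
    intro y r
    rw [MvPolynomial.eval_rename]
    congr 2
    exact funext fun j => extendZero_coe y j
  let S : Set (MvPolynomial {j // j ∈ I} ℝ) := {r | MvPolynomial.rename Subtype.val r ∈ HsetU G}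
  have hmem : ∀ r, r ∈ S ↔ MvPolynomial.rename Subtype.val r ∈ HsetU G := fun _ => Iff.rfl
  have add : ∀ a ∈ S, ∀ b ∈ S, a + b ∈ S := by
    intro a ha b hb
    rw [hmem, map_add]
    exact HsetU_add ha hb
  have mul : ∀ a ∈ S, ∀ b ∈ S, a * b ∈ S := by
    intro a ha b hb
    rw [hmem, map_mul]
    exact HsetU_mul ha hb
  have const : ∀ c : ℝ, 0 ≤ c → MvPolynomial.C c ∈ S := by
    intro c hc
    rw [hmem, MvPolynomial.rename_C]
    exact ⟨0, C_mem_HsetT hc 0⟩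
  have raise : ∀ {N M : ℝ} {r : MvPolynomial {j // j ∈ I} ℝ}, MvPolynomial.C N + r ∈ S → N ≤ M →
      MvPolynomial.C M + r ∈ S := by
    intro N M r h hNM
    convert add _ (const (M - N) (sub_nonneg.2 hNM)) _ h using 1
    rw [MvPolynomial.C_sub]
    ring
  have hX : ∀ j : {j // j ∈ I}, ∃ N : ℝ, MvPolynomial.C N + MvPolynomial.X j ∈ S ∧
      MvPolynomial.C N - MvPolynomial.X j ∈ S := by
    intro j
    obtain ⟨N, hN⟩ := exists_C_add_linear_mem_HsetU hsym haff hvars hbdd hne (Pi.single j 1)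
    obtain ⟨M, hM⟩ := exists_C_add_linear_mem_HsetU hsym haff hvars hbdd hne (Pi.single j (-1))
    have hN' : MvPolynomial.C N + MvPolynomial.X j ∈ S := by
      rw [hmem]
      simpa [Pi.single_apply, apply_ite MvPolynomial.C, ite_mul] using hN
    have hM' : MvPolynomial.C M + -MvPolynomial.X j ∈ S := by
      rw [hmem]
      simpa [Pi.single_apply, apply_ite MvPolynomial.C, ite_mul] using hM
    refine ⟨max N M, raise hN' (le_max_left N M), ?_⟩
    rw [sub_eq_add_neg]
    exact raise hM' (le_max_right N M)
  have hS : IsArchimedeanPreprime S :=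
    { add := fun {a b} ha hb => add a ha b hb
      mul := fun {a b} ha hb => mul a ha b hb
      const := fun {c} hc => const c hc
      bound := fun a => (MvPolynomial.exists_C_add_mem_and_C_sub_mem add mul const hX a).imp
        fun _ h => h.1 }
  obtain ⟨p', rfl⟩ := hrange p hp
  choose G' hG' using fun a b => hrange (G a b) (hvars a b)
  refine hS.mem_of_forall_character_pos fun φ hφ => ?_
  set y : {j // j ∈ I} → ℝ := fun j => φ (MvPolynomial.X j) with hy
  have hφe : ∀ r, φ r = MvPolynomial.eval y r := by
    intro r
    conv_lhs => rw [MvPolynomial.aeval_unique φ]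
    rfl
  rw [hφe, ← heval]
  refine hpos y (posSemidef_of_forall_sum_nonneg ?_ fun u => ?_)
  · ext a b
    simp only [evalMat, Matrix.transpose_apply, Matrix.of_apply, hsym.apply]
  · have hu : ∑ a, ∑ b, MvPolynomial.C (u a * u b) * G' a b ∈ S := by
      rw [hmem]
      convert tipP_mem_HsetU (G := G) (posSemidef_vecMulVec_self u) using 1
      simp [tipP, hG', Matrix.vecMulVec_apply]
    refine (hφ _ hu).trans_eq ?_
    rw [hφe]
    simp only [← heval, map_sum, map_mul, MvPolynomial.rename_C, MvPolynomial.eval_C, hG']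
    rfl

end positivstellensatz

theorem evalMat_posSemidef_iff {n q : ℕ} {G : Matrix (Fin q) (Fin q) (MvPolynomial (Fin n) ℝ)}
    (hsym : G.IsSymm) (x : Fin n → ℝ) : (evalMat x G).PosSemidef ↔
      ∀ u : Fin q → ℝ, 0 ≤ ∑ a, ∑ b, u a * u b * MvPolynomial.eval x (G a b) := by
  refine ⟨fun h u => (posSemidef_vecMulVec_self u).sum_mul_nonneg h, fun h =>
    posSemidef_of_forall_sum_nonneg ?_ h⟩
  ext a b
  simp only [evalMat, Matrix.transpose_apply, Matrix.of_apply, hsym.apply]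

theorem isClosed_setOf_evalMat_posSemidef {n q : ℕ}
    {G : Matrix (Fin q) (Fin q) (MvPolynomial (Fin n) ℝ)} (hsym : G.IsSymm) :
    IsClosed {x : Fin n → ℝ | (evalMat x G).PosSemidef} := by
  simp only [evalMat_posSemidef_iff hsym, Set.ofPred_forall]
  refine isClosed_iInter fun u => isClosed_le continuous_const ?_
  exact continuous_finsetSum _ fun a _ => continuous_finsetSum _ fun b _ =>
    continuous_const.mul (MvPolynomial.continuous_eval _)

theorem exists_sparse_certificate {n t : ℕ} {q : Fin t → ℕ} (I : Fin t → Finset (Fin n))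
    (hRIP : ∀ i : Fin t, 0 < (i : ℕ) →
      ∃ k : Fin t, k < i ∧
        I i ∩ (Finset.univ.filter (fun j : Fin t => j < i)).biUnion I ⊆ I k)
    (G : (i : Fin t) → Matrix (Fin (q i)) (Fin (q i)) (MvPolynomial (Fin n) ℝ))
    (hsym : ∀ i, (G i).IsSymm)
    (haff : ∀ i a b, ((G i) a b).totalDegree ≤ 1)
    (hvars : ∀ i a b, ((G i) a b).vars ⊆ I i)
    (hcomp : ∀ i, IsCompact (Kres (I i) (G i)))
    (hne : ∀ i, (Kres (I i) (G i)).Nonempty)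
    (hcover : ∀ j : Fin n, ∃ i, j ∈ I i)
    (fp : Fin t → MvPolynomial (Fin n) ℝ) (hfvars : ∀ i, (fp i).vars ⊆ I i)
    (hpos : ∀ x, (∀ i, (evalMat x (G i)).PosSemidef) → 0 < MvPolynomial.eval x (∑ i, fp i)) :
    ∃ m, ∃ h : Fin t → MvPolynomial (Fin n) ℝ,
      (∀ i, h i ∈ HsetT (G i) m) ∧ ∑ i, fp i = ∑ i, h i := by
  have hbd : ∀ i, ∃ R : ℝ, 0 ≤ R ∧ ∀ y ∈ Kres (I i) (G i), ∀ j, |y j| ≤ R := by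
    intro i
    obtain ⟨R, hR⟩ := (hcomp i).isBounded.exists_norm_le
    refine ⟨max R 0, le_max_right _ _, fun y hy j => ?_⟩
    exact (norm_le_pi_norm y j).trans ((hR y hy).trans (le_max_left _ _))
  choose R hR0 hR using hbd
  set B : Set (Fin n → ℝ) := {x | ∀ j, |x j| ≤ ∑ i, R i} with hB
  have hRle : ∀ i, R i ≤ ∑ i, R i := fun i =>
    Finset.single_le_sum (fun i _ => hR0 i) (Finset.mem_univ i)
  have hBc : IsCompact B := by
    have h : B = Set.pi Set.univ fun _ : Fin n => Set.Icc (-∑ i, R i) (∑ i, R i) := by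
      ext x
      simp only [hB, Set.mem_ofPred_eq, Set.mem_pi, Set.mem_univ, true_imp_iff, Set.mem_Icc, abs_le]
    rw [h]
    exact isCompact_univ_pi fun _ => isCompact_Icc
  have hPSD : ∀ i, ∀ x y : Fin n → ℝ, (∀ j ∈ I i, x j = y j) → evalMat x (G i) = evalMat y (G i) :=
    fun i x y h => by
      ext a b
      exact eval_eq_of_vars_subset (hvars i a b) h
  have hres : ∀ i, ∀ x : Fin n → ℝ, (evalMat x (G i)).PosSemidef →
      (fun j : {j // j ∈ I i} => x j) ∈ Kres (I i) (G i) := by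
    intro i x hx
    change (evalMat (extendZero (I i) fun j => x j) (G i)).PosSemidef
    rwa [hPSD i _ x fun j hj => extendZero_coe (fun j => x j) ⟨j, hj⟩]
  have hKB : ∀ x, (∀ i, (evalMat x (G i)).PosSemidef) → x ∈ B := by
    intro x hx j
    obtain ⟨i, hi⟩ := hcover j
    exact (hR i _ (hres i x (hx i)) ⟨j, hi⟩).trans (hRle i)
  obtain ⟨g, hgv, hg, hgpos⟩ := exists_sparse_decomposition B t I
    (fun i hi => by
      obtain ⟨k, hk, hsub⟩ := hRIP i hi
      refine ⟨k, hk, fun j hj i' hi' hj' => hsub (Finset.mem_inter.2 ⟨hj, ?_⟩)⟩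
      exact Finset.mem_biUnion.2 ⟨i', by simpa using hi', hj'⟩)
    (fun i => B ∩ {x | (evalMat x (G i)).PosSemidef})
    (fun i => Set.inter_subset_left)
    (fun i => hBc.inter_right (isClosed_setOf_evalMat_posSemidef (hsym i)))
    (fun i x hx y hy hxy => ⟨hy, by
      change (evalMat y (G i)).PosSemidef
      rw [← hPSD i x y hxy]
      exact hx.2⟩)
    (fun x hx y hy J j => by
      beta_reduce
      split_ifs
      exacts [hx j, hy j])
    fp hfvars (fun x hx => hpos x fun i => (hx i).2)
  have hm : ∀ i, ∃ m, g i ∈ HsetT (G i) m := fun i =>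
    exists_mem_HsetT_of_pos (hsym i) (haff i) (hvars i) (hcomp i).isBounded (hne i) (hgv i)
      fun y hy => hgpos i _ ⟨fun j => by
        unfold extendZero
        split_ifs with h
        · exact (hR i y hy _).trans (hRle i)
        · rw [abs_zero]
          exact Finset.sum_nonneg fun i _ => hR0 i, hy⟩
  choose m hm using hm
  exact ⟨Finset.univ.sup m, g, fun i => HsetT_mono (Finset.le_sup (Finset.mem_univ i)) (hm i), hg⟩

/-- **Convergence of the sparse SDP relaxations.**
With `[n] = I₁ ∪ ⋯ ∪ I_t` satisfying the running intersection property, `G_i`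
symmetric with affine entries in the variables `I_i`, each `K_i` compact with nonempty
interior in `ℝ^{|I_i|}`, `K = {x : G_i(x) ⪰ 0 ∀i}`, `f = ∑ f_i` with `f_i ∈ ℝ[x(I_i)]`,
`f* = min_K f`, and `f^sps_m = sup {r : f − r ∈ ∑ᵢ H_m(G_i)}` (in the extended reals,
`sup ∅ = ⊥`): the sequence `(f^sps_m)` is nondecreasing, bounded above by `f*`, and
converges to `f*`. -/
theorem sparse_sdp_relaxation_convergence {n t : ℕ} {q : Fin t → ℕ}
    (I : Fin t → Finset (Fin n))
    (hcover : ∀ j : Fin n, ∃ i, j ∈ I i)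
    (hRIP : ∀ i : Fin t, 0 < (i : ℕ) →
      ∃ k : Fin t, k < i ∧
        I i ∩ (Finset.univ.filter (fun j : Fin t => j < i)).biUnion I ⊆ I k)
    (G : (i : Fin t) → Matrix (Fin (q i)) (Fin (q i)) (MvPolynomial (Fin n) ℝ))
    (hsym : ∀ i, (G i).IsSymm)
    (haff : ∀ i a b, ((G i) a b).totalDegree ≤ 1)
    (hvars : ∀ i a b, ((G i) a b).vars ⊆ I i)
    (hcomp : ∀ i, IsCompact (Kres (I i) (G i)))
    (hint : ∀ i, (interior (Kres (I i) (G i))).Nonempty)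
    (K : Set (Fin n → ℝ))
    (hK : K = {x | ∀ i, (evalMat x (G i)).PosSemidef})
    (f : MvPolynomial (Fin n) ℝ) (fp : Fin t → MvPolynomial (Fin n) ℝ)
    (hfvars : ∀ i, (fp i).vars ⊆ I i)
    (hfsum : f = ∑ i, fp i)
    (fstar : ℝ)
    (hfstar : IsLeast {y : ℝ | ∃ x ∈ K, y = MvPolynomial.eval x f} fstar)
    (fm : ℕ → EReal)
    (hfm : ∀ m, fm m = sSup {z : EReal | ∃ r : ℝ, z = (r : EReal) ∧
      ∃ h : Fin t → MvPolynomial (Fin n) ℝ,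
        (∀ i, h i ∈ HsetT (G i) m) ∧ f - MvPolynomial.C r = ∑ i, h i}) :
    Monotone fm ∧ (∀ m, fm m ≤ (fstar : EReal)) ∧
      Filter.Tendsto fm Filter.atTop (nhds (fstar : EReal)) := by
  subst hK hfsum
  obtain ⟨⟨x₀, hx₀, hfx₀⟩, hmin⟩ := hfstar
  have hmono : Monotone fm := by
    intro m m' hm
    rw [hfm, hfm]
    refine sSup_le_sSup ?_
    rintro z ⟨r, hz, h, hh, he⟩
    exact ⟨r, hz, h, fun i => HsetT_mono hm (hh i), he⟩
  have hle : ∀ m, fm m ≤ (fstar : EReal) := by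
    intro m
    rw [hfm]
    refine sSup_le ?_
    rintro z ⟨r, rfl, h, hh, he⟩
    have h₁ : 0 ≤ MvPolynomial.eval x₀ (∑ i, h i) := by
      rw [map_sum]
      exact Finset.sum_nonneg fun i _ => HsetT_eval_nonneg (hh i) (hx₀ i)
    rw [← he, map_sub, MvPolynomial.eval_C, ← hfx₀, sub_nonneg] at h₁
    exact EReal.coe_le_coe_iff.2 h₁
  have hlow : ∀ r : ℝ, r < fstar → ∃ m, (r : EReal) ≤ fm m := by
    intro r hr
    rcases isEmpty_or_nonempty (Fin t) with ht | ⟨⟨i₀⟩⟩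
    · have h0 : fstar = 0 := by simpa using hfx₀
      refine ⟨0, hr.le |> EReal.coe_le_coe_iff.2 |>.trans ?_⟩
      rw [hfm]
      exact le_sSup ⟨fstar, rfl, 0, isEmptyElim, by simp [h0]⟩
    · have hsum : ∑ i, (fp i - if i = i₀ then MvPolynomial.C r else 0) =
          ∑ i, fp i - MvPolynomial.C r := by
        simp [Finset.sum_sub_distrib]
      obtain ⟨m, h, hh, he⟩ := exists_sparse_certificate I hRIP G hsym haff hvars hcomp
        (fun i => (hint i).mono interior_subset) hcover
        (fun i => fp i - if i = i₀ then MvPolynomial.C r else 0)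
        (fun i => (MvPolynomial.vars_sub_subset _).trans
          (Finset.union_subset (hfvars i) (by split_ifs <;> simp)))
        (fun x hx => by
          rw [hsum, map_sub, MvPolynomial.eval_C, sub_pos]
          exact hr.trans_le (hmin ⟨x, hx, rfl⟩))
      refine ⟨m, ?_⟩
      rw [hfm]
      exact le_sSup ⟨r, rfl, h, hh, hsum.symm.trans he⟩
  refine ⟨hmono, hle, tendsto_order.2 ⟨fun a ha => ?_, fun a ha =>
    Filter.Eventually.of_forall fun m => (hle m).trans_lt ha⟩⟩
  obtain ⟨r, har, hr⟩ := EReal.lt_iff_exists_real_btwn.1 ha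
  obtain ⟨m, hm⟩ := hlow r (EReal.coe_lt_coe_iff.1 hr)
  filter_upwards [Filter.eventually_ge_atTop m] with k hk
  exact har.trans_le (hm.trans (hmono hk))

end
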